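/- Let P₁ and P₂ be two transition kernels, π₁ and π₂ two policies, and R : S × A → ℝ a reward function with |R(s,a)| ≤ R_max for all (s,a). Define ε_π = max_{s∈S} D_TV(π₁(s), π₂(s)) and ε_M = (1−γ)·∑_{t=0}^∞ γ^t E_{(s,a)∼d_{π₁,P₁,t}}[ D_TV(P₁(s,a), P₂(s,a)) ] (the expected transition total variation under the discounted state–action distribution of π₁ in model P₁). Then |V(π₂, P₂, R) − V(π₁, P₁, R)| ≤ 2 R_max · ( ε_π/(1−γ)² + γ·ε_M/(1−γ)² ). -/

import Mathlib

open scoped BigOperators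

/-- Total variation distance between two PMFs on a finite type. -/
noncomputable def DTV {α : Type*} [Fintype α] (p q : PMF α) : ℝ :=
  (1 / 2) * ∑ x, |(p x).toReal - (q x).toReal|

/-- The time-`t` state–action distribution of policy `π` in the MDP with transition
kernel `P` and initial state distribution `ρ₀`. -/
noncomputable def stateActionDist {S A : Type*} (π : S → PMF A) (P : S × A → PMF S)
    (ρ₀ : PMF S) : ℕ → PMF (S × A)
  | 0 => ρ₀.bind fun s => (π s).map fun a => (s, a)
  | (t + 1) => (stateActionDist π P ρ₀ t).bind fun sa =>
      (P sa).bind fun s' => (π s').map fun a' => (s', a')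

/-- The expected discounted return of policy `π` under transition kernel `P`,
initial distribution `ρ₀`, discount `γ` and reward `R`. -/
noncomputable def Vret {S A : Type*} [Fintype S] [Fintype A] (π : S → PMF A)
    (P : S × A → PMF S) (ρ₀ : PMF S) (γ : ℝ) (R : S × A → ℝ) : ℝ :=
  ∑' t : ℕ, γ ^ t * ∑ sa : S × A, ((stateActionDist π P ρ₀ t) sa).toReal * R sa

theorem PMF.sum_toReal_eq_one {α : Type*} [Fintype α] (p : PMF α) :
    ∑ x, (p x).toReal = 1 := by
  rw [← ENNReal.toReal_sum fun x _ => p.apply_ne_top x, ← tsum_fintype (L := .unconditional _),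
    p.tsum_coe, ENNReal.toReal_one]

theorem PMF.toReal_bind_apply {α β : Type*} [Fintype α] (p : PMF α) (f : α → PMF β) (b : β) :
    (p.bind f b).toReal = ∑ a, (p a).toReal * (f a b).toReal := by
  rw [PMF.bind_apply, tsum_fintype, ENNReal.toReal_sum fun a _ =>
    ENNReal.mul_ne_top (p.apply_ne_top a) ((f a).apply_ne_top b)]
  simp only [ENNReal.toReal_mul]

theorem DTV_nonneg {α : Type*} [Fintype α] (p q : PMF α) : 0 ≤ DTV p q := by
  unfold DTV
  positivity

@[simp]
theorem DTV_self {α : Type*} [Fintype α] (p : PMF α) : DTV p p = 0 := by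
  simp [DTV]

theorem DTV_le_one {α : Type*} [Fintype α] (p q : PMF α) : DTV p q ≤ 1 := by
  have h : ∑ x, |(p x).toReal - (q x).toReal| ≤ ∑ x, ((p x).toReal + (q x).toReal) :=
    Finset.sum_le_sum fun x _ => by
      have hp : 0 ≤ (p x).toReal := ENNReal.toReal_nonneg
      have hq : 0 ≤ (q x).toReal := ENNReal.toReal_nonneg
      rw [abs_le]
      constructor <;> linarith
  rw [Finset.sum_add_distrib, p.sum_toReal_eq_one, q.sum_toReal_eq_one] at h
  unfold DTV
  linarith

theorem PMF.abs_sum_toReal_mul_le {α : Type*} [Fintype α] (p : PMF α) {f : α → ℝ} {C : ℝ}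
    (hf : ∀ a, |f a| ≤ C) : |∑ a, (p a).toReal * f a| ≤ C :=
  calc |∑ a, (p a).toReal * f a| ≤ ∑ a, |(p a).toReal * f a| := Finset.abs_sum_le_sum_abs _ _
    _ ≤ ∑ a, (p a).toReal * C := Finset.sum_le_sum fun a _ => by
        rw [abs_mul, abs_of_nonneg ENNReal.toReal_nonneg]
        exact mul_le_mul_of_nonneg_left (hf a) ENNReal.toReal_nonneg
    _ = C := by rw [← Finset.sum_mul, p.sum_toReal_eq_one, one_mul]

/-- Hybrid bound for the total variation distance between two mixtures. -/
theorem DTV_bind_le {α β : Type*} [Fintype α] [Fintype β] (p q : PMF α) (f g : α → PMF β) :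
    DTV (p.bind f) (q.bind g) ≤ DTV p q + ∑ a, (p a).toReal * DTV (f a) (g a) := by
  have hpt (b : β) : |(p.bind f b).toReal - (q.bind g b).toReal| ≤
      ∑ a, (|(p a).toReal - (q a).toReal| * (g a b).toReal +
        (p a).toReal * |(f a b).toReal - (g a b).toReal|) := by
    rw [PMF.toReal_bind_apply, PMF.toReal_bind_apply, ← Finset.sum_sub_distrib]
    refine (Finset.abs_sum_le_sum_abs _ _).trans (Finset.sum_le_sum fun a _ => ?_)
    have hg : |(g a b).toReal| = (g a b).toReal := abs_of_nonneg ENNReal.toReal_nonneg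
    have hp : |(p a).toReal| = (p a).toReal := abs_of_nonneg ENNReal.toReal_nonneg
    calc |(p a).toReal * (f a b).toReal - (q a).toReal * (g a b).toReal|
        = |((p a).toReal - (q a).toReal) * (g a b).toReal +
            (p a).toReal * ((f a b).toReal - (g a b).toReal)| := by congr 1; ring
      _ ≤ _ := (abs_add_le _ _).trans_eq (by rw [abs_mul, abs_mul, hg, hp])
  have hsum := Finset.sum_le_sum fun b (_ : b ∈ Finset.univ) => hpt b
  rw [Finset.sum_comm] at hsum
  simp only [Finset.sum_add_distrib, ← Finset.mul_sum, PMF.sum_toReal_eq_one, mul_one] at hsum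
  simp only [DTV, mul_left_comm _ (1 / 2 : ℝ), ← Finset.mul_sum]
  linarith

theorem DTV_map_le {α β : Type*} [Fintype α] [Fintype β] (p q : PMF α) (f : α → β) :
    DTV (p.map f) (q.map f) ≤ DTV p q := by
  simpa [PMF.map, Function.comp_def] using
    DTV_bind_le p q (fun a => PMF.pure (f a)) fun a => PMF.pure (f a)

theorem DTV_bind_map_prodMk_le {S A : Type*} [Fintype S] [Fintype A] (p q : PMF S)
    (π₁ π₂ : S → PMF A) :
    DTV (p.bind fun s => (π₁ s).map fun a => (s, a)) (q.bind fun s => (π₂ s).map fun a => (s, a)) ≤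
      DTV p q + ⨆ s, DTV (π₁ s) (π₂ s) := by
  refine (DTV_bind_le _ _ _ _).trans (add_le_add_right ?_ _)
  refine (le_abs_self _).trans (p.abs_sum_toReal_mul_le fun s => ?_)
  rw [abs_of_nonneg (DTV_nonneg _ _)]
  exact (DTV_map_le _ _ _).trans
    (le_ciSup (f := fun s => DTV (π₁ s) (π₂ s)) (Set.finite_range _).bddAbove s)

theorem DTV_stateActionDist_succ_le {S A : Type*} [Fintype S] [Fintype A] (ρ₀ : PMF S)
    (P₁ P₂ : S × A → PMF S) (π₁ π₂ : S → PMF A) (t : ℕ) :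
    DTV (stateActionDist π₁ P₁ ρ₀ (t + 1)) (stateActionDist π₂ P₂ ρ₀ (t + 1)) ≤
      DTV (stateActionDist π₁ P₁ ρ₀ t) (stateActionDist π₂ P₂ ρ₀ t) +
        ∑ sa, (stateActionDist π₁ P₁ ρ₀ t sa).toReal * DTV (P₁ sa) (P₂ sa) +
        ⨆ s, DTV (π₁ s) (π₂ s) := by
  simp only [stateActionDist, ← PMF.bind_bind]
  exact (DTV_bind_map_prodMk_le _ _ _ _).trans (add_le_add_left (DTV_bind_le _ _ _ _) _)

theorem abs_sum_toReal_mul_sub_le {α : Type*} [Fintype α] (p q : PMF α) {f : α → ℝ} {C : ℝ}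
    (hf : ∀ a, |f a| ≤ C) :
    |∑ a, (q a).toReal * f a - ∑ a, (p a).toReal * f a| ≤ 2 * C * DTV p q := by
  rw [← Finset.sum_sub_distrib]
  calc _ ≤ ∑ a, |(q a).toReal * f a - (p a).toReal * f a| := Finset.abs_sum_le_sum_abs _ _
    _ ≤ ∑ a, |(p a).toReal - (q a).toReal| * C := Finset.sum_le_sum fun a _ => by
        rw [← sub_mul, abs_mul, abs_sub_comm]
        exact mul_le_mul_of_nonneg_left (hf a) (abs_nonneg _)
    _ = 2 * C * DTV p q := by rw [← Finset.sum_mul, DTV]; ring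

theorem summable_pow_mul_of_abs_le {γ : ℝ} (hγ0 : 0 ≤ γ) (hγ1 : γ < 1) {u : ℕ → ℝ} {C : ℝ}
    (hu : ∀ t, |u t| ≤ C) : Summable fun t => γ ^ t * u t :=
  ((summable_geometric_of_lt_one hγ0 hγ1).mul_right C).of_norm_bounded fun t => by
    rw [Real.norm_eq_abs, abs_mul, abs_of_nonneg (pow_nonneg hγ0 t)]
    exact mul_le_mul_of_nonneg_left (hu t) (pow_nonneg hγ0 t)

/-- Discounted Grönwall inequality. -/
theorem tsum_pow_mul_le_of_succ_le {γ : ℝ} (hγ0 : 0 ≤ γ) (hγ1 : γ < 1) {D e : ℕ → ℝ} {ε : ℝ}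
    (hD : Summable fun t => γ ^ t * D t) (he : Summable fun t => γ ^ t * e t)
    (h0 : D 0 ≤ ε) (hsucc : ∀ t, D (t + 1) ≤ D t + e t + ε) :
    ∑' t, γ ^ t * D t ≤ ε / (1 - γ) ^ 2 + γ * (∑' t, γ ^ t * e t) / (1 - γ) := by
  have hε := (summable_geometric_of_lt_one hγ0 hγ1).mul_right ε
  have hstep : ∑' t, γ ^ (t + 1) * D (t + 1) ≤
      ∑' t, γ * (γ ^ t * D t + γ ^ t * e t + γ ^ t * ε) :=
    ((summable_nat_add_iff 1).2 hD).tsum_le_tsum (fun t => by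
      rw [pow_succ', ← mul_add, ← mul_add, mul_assoc]
      exact mul_le_mul_of_nonneg_left
        (mul_le_mul_of_nonneg_left (hsucc t) (pow_nonneg hγ0 t)) hγ0)
      (((hD.add he).add hε).mul_left γ)
  rw [tsum_mul_left, (hD.add he).tsum_add hε, hD.tsum_add he, tsum_mul_right,
    tsum_geometric_of_lt_one hγ0 hγ1] at hstep
  have hsplit := hD.tsum_eq_zero_add
  rw [pow_zero, one_mul] at hsplit
  have hpos : 0 < 1 - γ := sub_pos.2 hγ1
  have hinv : γ * ((1 - γ)⁻¹ * ε) + ε = ε / (1 - γ) := by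
    field_simp
    ring
  have hrhs : ε / (1 - γ) ^ 2 + γ * (∑' t, γ ^ t * e t) / (1 - γ) =
      (ε / (1 - γ) + γ * ∑' t, γ ^ t * e t) / (1 - γ) := by
    field_simp
  rw [hrhs, le_div_iff₀ hpos]
  linarith

/-- **Return bound** (Lemma 1, from Zhang et al. 2023): the gap in expected return
between two policies run in two models is controlled by the maximal policy total
variation and the expected transition total variation. -/
theorem return_bound_two_models
    {S A : Type*} [Fintype S] [Nonempty S] [Fintype A] [Nonempty A]
    (ρ₀ : PMF S) (γ : ℝ) (hγ0 : 0 ≤ γ) (hγ1 : γ < 1)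
    (P₁ P₂ : S × A → PMF S) (π₁ π₂ : S → PMF A)
    (R : S × A → ℝ) (Rmax : ℝ) (hRmax : 0 ≤ Rmax) (hR : ∀ sa, |R sa| ≤ Rmax) :
    |Vret π₂ P₂ ρ₀ γ R - Vret π₁ P₁ ρ₀ γ R| ≤
      2 * Rmax * ((⨆ s, DTV (π₁ s) (π₂ s)) / (1 - γ) ^ 2 +
        γ * ((1 - γ) * ∑' t : ℕ, γ ^ t *
            ∑ sa : S × A, ((stateActionDist π₁ P₁ ρ₀ t) sa).toReal * DTV (P₁ sa) (P₂ sa)) /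
          (1 - γ) ^ 2) := by
  have hsum (π : S → PMF A) (P : S × A → PMF S) : Summable fun t : ℕ =>
      γ ^ t * ∑ sa : S × A, ((stateActionDist π P ρ₀ t) sa).toReal * R sa :=
    summable_pow_mul_of_abs_le hγ0 hγ1 fun t => PMF.abs_sum_toReal_mul_le _ hR
  have hD : Summable fun t : ℕ =>
      γ ^ t * DTV (stateActionDist π₁ P₁ ρ₀ t) (stateActionDist π₂ P₂ ρ₀ t) :=
    summable_pow_mul_of_abs_le (C := 1) hγ0 hγ1 fun t => by
      rw [abs_of_nonneg (DTV_nonneg _ _)]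
      exact DTV_le_one _ _
  have he : Summable fun t : ℕ => γ ^ t *
      ∑ sa : S × A, ((stateActionDist π₁ P₁ ρ₀ t) sa).toReal * DTV (P₁ sa) (P₂ sa) :=
    summable_pow_mul_of_abs_le (C := 1) hγ0 hγ1 fun t => PMF.abs_sum_toReal_mul_le _ fun sa => by
      rw [abs_of_nonneg (DTV_nonneg _ _)]
      exact DTV_le_one _ _
  have h0 : DTV (stateActionDist π₁ P₁ ρ₀ 0) (stateActionDist π₂ P₂ ρ₀ 0) ≤
      ⨆ s, DTV (π₁ s) (π₂ s) := by
    simpa [stateActionDist] using DTV_bind_map_prodMk_le ρ₀ ρ₀ π₁ π₂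
  have hmain := tsum_pow_mul_le_of_succ_le hγ0 hγ1 hD he h0
    (DTV_stateActionDist_succ_le ρ₀ P₁ P₂ π₁ π₂)
  have hpos : 0 < 1 - γ := sub_pos.2 hγ1
  calc |Vret π₂ P₂ ρ₀ γ R - Vret π₁ P₁ ρ₀ γ R|
      ≤ ∑' t : ℕ, 2 * Rmax *
          (γ ^ t * DTV (stateActionDist π₁ P₁ ρ₀ t) (stateActionDist π₂ P₂ ρ₀ t)) := by
        rw [Vret, Vret, ← (hsum π₂ P₂).tsum_sub (hsum π₁ P₁), ← Real.norm_eq_abs]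
        refine tsum_of_norm_bounded (hD.mul_left (2 * Rmax)).hasSum fun t => ?_
        rw [Real.norm_eq_abs, ← mul_sub, abs_mul, abs_of_nonneg (pow_nonneg hγ0 t),
          mul_left_comm]
        exact mul_le_mul_of_nonneg_left (abs_sum_toReal_mul_sub_le _ _ hR) (pow_nonneg hγ0 t)
    _ ≤ _ := by
        rw [tsum_mul_left]
        refine mul_le_mul_of_nonneg_left (hmain.trans_eq ?_) (by positivity)
        congr 1
        field_simp
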